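/- Fix m ∈ ℕ and for each N ≥ m let V_{m,N} be the m×N matrix consisting of the first m rows of a Haar-distributed matrix A_N ∈ O(N) (so V_{m,N} is Haar-distributed on the Stiefel manifold 𝕍_{m,N}), embedded into ℝ^{m×∞} by padding with zeros and equipping ℝ^{m×∞} with the product topology. Let β_N be a sequence of positive reals with β_N → ∞ and β_N = o(√N). Then β_N·V_{m,N} satisfies a large deviation principle on ℝ^{m×∞} with speed N/β_N² and good convex rate function I(A) = (1/2)·∑_{i=1}^m ∑_{j=1}^∞ A_{i,j}² (equal to +∞ if the entries of A are not square-summable); that is, for every open O ⊆ ℝ^{m×∞}, liminf_{N→∞} (β_N²/N)·log ℙ(β_N·V_{m,N} ∈ O) ≥ −inf_{A∈O} I(A), and for every closed C ⊆ ℝ^{m×∞}, limsup_{N→∞} (β_N²/N)·log ℙ(β_N·V_{m,N} ∈ C) ≤ −inf_{A∈C} I(A). -/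

import Mathlib

open MeasureTheory Filter Matrix Asymptotics

noncomputable instance matrixMeasurableSpace {N : ℕ} :
    MeasurableSpace (Matrix (Fin N) (Fin N) ℝ) :=
  show MeasurableSpace (Fin N → Fin N → ℝ) from inferInstance

/-- The first `m` rows of an `N × N` matrix, embedded into `ℝ^{m × ∞}` by padding
with zeros. -/
def rowsEmb (m : ℕ) {N : ℕ} (A : Matrix (Fin N) (Fin N) ℝ) : Fin m → ℕ → ℝ :=
  fun i j => if h : (i : ℕ) < N ∧ j < N then A ⟨i, h.1⟩ ⟨j, h.2⟩ else 0

open scoped Classical in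
/-- The good convex rate function `I(A) = (1/2) ∑_{i,j} A_{i,j}²` on `ℝ^{m × ∞}`,
equal to `+∞` if the entries are not square-summable. -/
noncomputable def rateI (m : ℕ) (A : Fin m → ℕ → ℝ) : EReal :=
  if Summable (fun p : Fin m × ℕ => (A p.1 p.2) ^ 2) then
    (((1 : ℝ) / 2) * ∑' p : Fin m × ℕ, (A p.1 p.2) ^ 2 : ℝ)
  else ⊤

section LinearAlgebra

open scoped Matrix.Norms.Frobenius MatrixOrder

lemma frobenius_norm_sq {a b : Type*} [Fintype a] [Fintype b] (A : Matrix a b ℝ) :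
    ‖A‖ ^ 2 = ∑ i, ∑ j, A i j ^ 2 := by
  rw [Matrix.frobenius_norm_def, ← Real.sqrt_eq_rpow, Real.sq_sqrt (by positivity)]
  simp

lemma frobenius_norm_sq_eq_trace {a b : Type*} [Fintype a] [Fintype b] (A : Matrix a b ℝ) :
    ‖A‖ ^ 2 = (Aᵀ * A).trace := by
  rw [frobenius_norm_sq, Finset.sum_comm]
  simp [Matrix.trace, Matrix.mul_apply, sq]

/-- A matrix close to the identity which is positive semidefinite has a square root that is at
least as close to the identity. -/
lemma exists_sqrt_near_one {a : Type*} [Fintype a] [DecidableEq a] {Y : Matrix a a ℝ}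
    (hY : Y.PosSemidef) : ∃ S : Matrix a a ℝ, Sᵀ = S ∧ S * S = Y ∧ ‖S - 1‖ ≤ ‖Y - 1‖ := by
  have hY0 : 0 ≤ Y := hY.nonneg
  have hS : (CFC.sqrt Y).PosSemidef := (CFC.sqrt_nonneg Y).posSemidef
  have hSS : CFC.sqrt Y * CFC.sqrt Y = Y := CFC.sqrt_mul_sqrt_self Y hY0
  have hT : (CFC.sqrt Y)ᵀ = CFC.sqrt Y := by
    simpa [Matrix.IsHermitian] using hS.1
  refine ⟨CFC.sqrt Y, hT, hSS, ?_⟩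
  generalize CFC.sqrt Y = S at *
  subst hSS
  have hD : (S - 1)ᵀ = S - 1 := by simp [hT]
  have h1 : 0 ≤ ((S - 1) * S * (S - 1)).trace := by
    have := (hS.mul_mul_conjTranspose_same (S - 1)).trace_nonneg
    rwa [Matrix.conjTranspose_eq_transpose_of_trivial, hD] at this
  have h2 : 0 ≤ ((S - 1) * (S * S) * (S - 1)).trace := by
    have := (hY.mul_mul_conjTranspose_same (S - 1)).trace_nonneg
    rwa [Matrix.conjTranspose_eq_transpose_of_trivial, hD] at this
  refine le_of_sq_le_sq ?_ (norm_nonneg _)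
  rw [frobenius_norm_sq_eq_trace, frobenius_norm_sq_eq_trace, hD]
  have hE : (S * S - 1)ᵀ = S * S - 1 := by simp [hT]
  have : (S * S - 1)ᵀ * (S * S - 1) = (S - 1) * (S * S) * (S - 1)
      + (2 : ℝ) • ((S - 1) * S * (S - 1)) + (S - 1) * (S - 1) := by
    rw [hE, two_smul]; noncomm_ring
  rw [this, Matrix.trace_add, Matrix.trace_add, Matrix.trace_smul, smul_eq_mul]
  linarith

/-- A matrix with orthonormal rows extends to an orthogonal matrix. -/
lemma exists_orthogonal_extension {m N : ℕ} (hmN : m ≤ N) {W : Matrix (Fin m) (Fin N) ℝ}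
    (hW : W * Wᵀ = 1) : ∃ Q : Matrix (Fin N) (Fin N) ℝ, Q * Qᵀ = 1 ∧
      Q.submatrix (Fin.castLE hmN) id = W := by
  classical
  let v : Fin N → EuclideanSpace ℝ (Fin N) := fun i =>
    if h : (i : ℕ) < m then WithLp.toLp 2 (W ⟨i, h⟩) else 0
  let s : Set (Fin N) := {i | (i : ℕ) < m}
  have hv : Orthonormal ℝ (s.domRestrict v) := by
    rw [orthonormal_iff_ite]
    rintro ⟨i, hi⟩ ⟨j, hj⟩
    have hi' : (i : ℕ) < m := hi
    have hj' : (j : ℕ) < m := hj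
    have := congrFun (congrFun hW ⟨i, hi'⟩) ⟨j, hj'⟩
    rw [Matrix.mul_apply, Matrix.one_apply] at this
    simp only [Fin.mk.injEq, Matrix.transpose_apply] at this
    simp only [Set.domRestrict_apply, v, hi', hj', dif_pos, EuclideanSpace.inner_eq_star_dotProduct,
      Subtype.mk.injEq]
    simp only [Fin.ext_iff, ← this]
    simp [dotProduct, mul_comm]
  obtain ⟨b, hb⟩ := hv.exists_orthonormalBasis_extension_of_card_eq (by simp)
  refine ⟨Matrix.of fun i j => b i j, ?_, ?_⟩
  · ext i j
    have := (orthonormal_iff_ite.1 b.orthonormal) i j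
    rw [Matrix.mul_apply, Matrix.one_apply, ← this]
    simp [EuclideanSpace.inner_eq_star_dotProduct, dotProduct, mul_comm]
  · ext i j
    have := hb (Fin.castLE hmN i) (by simp [s])
    simp [this, v]

/-- Polar decomposition of a wide matrix whose Gram matrix is close to a multiple of the
identity. -/
lemma exists_polar {m N : ℕ} (hmN : m ≤ N) {c : ℝ} (hc : 0 < c) (Z : Matrix (Fin m) (Fin N) ℝ)
    {δ : ℝ} (hδ : δ < 1) (hZ : ‖(c ^ 2)⁻¹ • (Z * Zᵀ) - 1‖ ≤ δ) :
    ∃ S : Matrix (Fin m) (Fin m) ℝ, ‖S - 1‖ ≤ δ ∧ ∃ Q : Matrix (Fin N) (Fin N) ℝ, Q * Qᵀ = 1 ∧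
      Z = c • (S * Q.submatrix (Fin.castLE hmN) id) := by
  have hY : ((c ^ 2)⁻¹ • (Z * Zᵀ)).PosSemidef := by
    have := Matrix.posSemidef_self_mul_conjTranspose Z
    rw [Matrix.conjTranspose_eq_transpose_of_trivial] at this
    exact this.smul (by positivity)
  obtain ⟨S, hST, hSS, hS⟩ := exists_sqrt_near_one hY
  have hS1 : ‖S - 1‖ ≤ δ := hS.trans hZ
  refine ⟨S, hS1, ?_⟩
  have hU : IsUnit S := by
    have := isUnit_one_sub_of_norm_lt_one (x := 1 - S) (by rw [norm_sub_rev]; linarith)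
    simpa using this
  have hdet : IsUnit S.det := (Matrix.isUnit_iff_isUnit_det S).1 hU
  obtain ⟨Q, hQ, hQW⟩ := exists_orthogonal_extension hmN (W := c⁻¹ • (S⁻¹ * Z)) (by
    rw [Matrix.transpose_smul, Matrix.transpose_mul, Matrix.transpose_nonsing_inv, hST,
      Matrix.smul_mul, Matrix.mul_smul, smul_smul, ← mul_inv, ← sq,
      show S⁻¹ * Z * (Zᵀ * S⁻¹) = S⁻¹ * (Z * Zᵀ) * S⁻¹ by simp only [Matrix.mul_assoc],
      ← Matrix.smul_mul, ← Matrix.mul_smul, ← hSS, ← Matrix.mul_assoc,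
      Matrix.nonsing_inv_mul _ hdet, Matrix.one_mul, Matrix.mul_nonsing_inv _ hdet])
  refine ⟨Q, hQ, ?_⟩
  rw [hQW, Matrix.mul_smul, smul_smul, mul_inv_cancel₀ hc.ne', one_smul, ← Matrix.mul_assoc,
    Matrix.mul_nonsing_inv _ hdet, Matrix.one_mul]

/-- If `S` is close to the identity then `S * V` is comparable to `V`. -/
lemma norm_le_norm_mul_of_near_one {a b : Type*} [Fintype a] [Fintype b] [DecidableEq a]
    {S : Matrix a a ℝ} {δ : ℝ} (hS : ‖S - 1‖ ≤ δ) (V : Matrix a b ℝ) :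
    (1 - δ) * ‖V‖ ≤ ‖S * V‖ ∧ ‖S * V - V‖ ≤ δ * ‖V‖ := by
  have h1 : ‖S * V - V‖ ≤ δ * ‖V‖ := by
    have := Matrix.frobenius_norm_mul (S - 1) V
    rw [Matrix.sub_mul, Matrix.one_mul] at this
    exact this.trans (by gcongr)
  refine ⟨?_, h1⟩
  have := norm_sub_norm_le V (S * V)
  rw [norm_sub_rev] at this
  linarith

lemma abs_apply_le_frobenius_norm {a b : Type*} [Fintype a] [Fintype b] (A : Matrix a b ℝ)
    (i : a) (j : b) : |A i j| ≤ ‖A‖ := by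
  refine abs_le_of_sq_le_sq ?_ (norm_nonneg _)
  rw [frobenius_norm_sq]
  calc A i j ^ 2 ≤ ∑ j, A i j ^ 2 :=
        Finset.single_le_sum (f := fun j => A i j ^ 2) (fun _ _ => sq_nonneg _) (Finset.mem_univ j)
    _ ≤ _ := Finset.single_le_sum (f := fun i => ∑ j, A i j ^ 2)
        (fun _ _ => Finset.sum_nonneg fun _ _ => sq_nonneg _) (Finset.mem_univ i)

lemma frobenius_norm_le_of_abs_le {a : Type*} [Fintype a] (A : Matrix a a ℝ) {η : ℝ}
    (hη : 0 ≤ η) (hA : ∀ i j, |A i j| ≤ η) : ‖A‖ ≤ Fintype.card a * η := by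
  refine le_of_sq_le_sq ?_ (by positivity)
  rw [frobenius_norm_sq]
  calc ∑ i, ∑ j, A i j ^ 2 ≤ ∑ _i : a, ∑ _j : a, η ^ 2 := by
        refine Finset.sum_le_sum fun i _ => Finset.sum_le_sum fun j _ => ?_
        exact sq_le_sq.2 ((hA i j).trans (le_abs_self _))
    _ = _ := by simp; ring

end LinearAlgebra

section GaussianComparison

open ProbabilityTheory
open scoped Matrix.Norms.Frobenius

/-- The matrix whose entries are listed by a vector indexed by pairs. -/
def toMat {m N : ℕ} (z : Fin m × Fin N → ℝ) : Matrix (Fin m) (Fin N) ℝ :=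
  Matrix.of fun i j => z (i, j)

/-- The vector of all entries of a matrix. -/
def flat {m N : ℕ} (M : Matrix (Fin m) (Fin N) ℝ) : Fin m × Fin N → ℝ := fun p => M p.1 p.2

@[simp] lemma toMat_flat {m N : ℕ} (M : Matrix (Fin m) (Fin N) ℝ) : toMat (flat M) = M := rfl

/-- The law of a matrix with independent standard Gaussian entries. -/
noncomputable def gaussMat (m N : ℕ) : Measure (Fin m × Fin N → ℝ) :=
  Measure.pi fun _ => gaussianReal 0 1

instance (m N : ℕ) : IsProbabilityMeasure (gaussMat m N) := by
  unfold gaussMat; infer_instance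

lemma norm_toLp_eq {m N : ℕ} (z : Fin m × Fin N → ℝ) :
    ‖(WithLp.toLp 2 z : EuclideanSpace ℝ (Fin m × Fin N))‖ = ‖toMat z‖ := by
  refine (sq_eq_sq₀ (norm_nonneg _) (norm_nonneg _)).1 ?_
  rw [EuclideanSpace.norm_sq_eq, frobenius_norm_sq, Fintype.sum_prod_type]
  simp [toMat]

lemma map_gaussMat_mul {m N : ℕ} {A : Matrix (Fin N) (Fin N) ℝ} (hA : A * Aᵀ = 1) :
    (gaussMat m N).map (fun z => flat (toMat z * A)) = gaussMat m N := by
  let L : EuclideanSpace ℝ (Fin m × Fin N) →ₗ[ℝ] EuclideanSpace ℝ (Fin m × Fin N) :=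
    { toFun := fun z => WithLp.toLp 2 (flat (toMat z.ofLp * A))
      map_add' := fun x y => by
        ext p
        simp [flat, toMat, Matrix.mul_apply, add_mul, Finset.sum_add_distrib]
      map_smul' := fun c x => by
        ext p
        simp [flat, toMat, Matrix.mul_apply, Finset.mul_sum, mul_assoc] }
  let I : EuclideanSpace ℝ (Fin m × Fin N) →ₗᵢ[ℝ] EuclideanSpace ℝ (Fin m × Fin N) :=
    { toLinearMap := L
      norm_map' := fun z => by
        have h1 : ‖L z‖ = ‖toMat z.ofLp * A‖ := norm_toLp_eq _
        have h2 : ‖z‖ = ‖toMat z.ofLp‖ := norm_toLp_eq _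
        rw [h1, h2]
        refine (sq_eq_sq₀ (norm_nonneg _) (norm_nonneg _)).1 ?_
        rw [frobenius_norm_sq_eq_trace, frobenius_norm_sq_eq_trace, Matrix.trace_mul_comm,
          Matrix.trace_mul_comm (toMat z.ofLp)ᵀ, Matrix.transpose_mul, Matrix.mul_assoc,
          ← Matrix.mul_assoc A, hA, Matrix.one_mul] }
  let e := I.toLinearIsometryEquiv rfl
  have he := stdGaussian_map e
  rw [← map_pi_eq_stdGaussian, Measure.map_map (by fun_prop) (by fun_prop)] at he
  have := congrArg (Measure.map (WithLp.ofLp : EuclideanSpace ℝ (Fin m × Fin N) → _)) he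
  rw [Measure.map_map (by fun_prop) (by fun_prop), Measure.map_map (by fun_prop) (by fun_prop)]
    at this
  have h3 : (WithLp.ofLp : EuclideanSpace ℝ (Fin m × Fin N) → _) ∘ (WithLp.toLp 2) = id := rfl
  rw [h3, Measure.map_id] at this
  exact this

lemma measurable_flat_mul {m N : ℕ} : Measurable
    (fun q : (Fin m × Fin N → ℝ) × Matrix (Fin N) (Fin N) ℝ => flat (toMat q.1 * q.2)) := by
  refine measurable_pi_lambda _ fun p => ?_
  simp only [flat, toMat, Matrix.mul_apply, Matrix.of_apply]
  refine Finset.measurable_sum _ fun l _ => ?_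
  refine ((measurable_pi_apply (p.1, l)).comp measurable_fst).mul ?_
  have h : Measurable fun A : Fin N → Fin N → ℝ => A l p.2 := by fun_prop
  exact h.comp measurable_snd

lemma measurable_rows {m N : ℕ} (hmN : m ≤ N) (c : ℝ) (S : Matrix (Fin m) (Fin m) ℝ) : Measurable
    (fun A : Matrix (Fin N) (Fin N) ℝ => flat (c • (S * A.submatrix (Fin.castLE hmN) id))) := by
  refine measurable_pi_lambda _ fun p => ?_
  simp only [flat, Matrix.mul_apply, Matrix.smul_apply, Matrix.submatrix_apply]
  have h : Measurable fun A : Fin N → Fin N → ℝ =>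
    c • ∑ l, S p.1 l * A (Fin.castLE hmN l) p.2 := by fun_prop
  exact h

lemma measurable_mul_left_matrix {N : ℕ} (B : Matrix (Fin N) (Fin N) ℝ) :
    Measurable (fun A : Matrix (Fin N) (Fin N) ℝ => B * A) := by
  have : Measurable fun A : Fin N → Fin N → ℝ => fun i j => ∑ l, B i l * A l j := by fun_prop
  exact this

lemma ae_orthogonal {N : ℕ} {μ : Measure (Matrix (Fin N) (Fin N) ℝ)} [IsProbabilityMeasure μ]
    (hμ : μ {A | A * Aᵀ = 1} = 1) : ∀ᵐ A ∂μ, A * Aᵀ = 1 := by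
  refine (mem_ae_iff_prob_eq_one₀ (MeasurableSet.nullMeasurableSet ?_)).2 hμ
  have h : MeasurableSet (⋂ i, ⋂ j, {A : Fin N → Fin N → ℝ |
      ∑ l, A i l * A j l = (1 : Matrix (Fin N) (Fin N) ℝ) i j}) :=
    MeasurableSet.iInter fun i => MeasurableSet.iInter fun j =>
      measurableSet_eq_fun (by fun_prop) (by fun_prop)
  have heq : {A : Matrix (Fin N) (Fin N) ℝ | A * Aᵀ = 1} = ⋂ i, ⋂ j, {A : Fin N → Fin N → ℝ |
      ∑ l, A i l * A j l = (1 : Matrix (Fin N) (Fin N) ℝ) i j} := by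
    refine Set.ext fun A => ⟨fun hA => ?_, fun hA => ?_⟩
    · exact Set.mem_iInter.2 fun i => Set.mem_iInter.2 fun j => congrFun (congrFun hA i) j
    · exact Matrix.ext fun i j => Set.mem_iInter.1 (Set.mem_iInter.1 hA i) j
  rw [heq]
  exact h

variable {m N : ℕ} {μ : Measure (Matrix (Fin N) (Fin N) ℝ)}

lemma gaussMat_eq_lintegral [IsProbabilityMeasure μ] (hμ : μ {A | A * Aᵀ = 1} = 1)
    {E : Set (Fin m × Fin N → ℝ)} (hE : MeasurableSet E) :
    gaussMat m N E = ∫⁻ z, μ {A | flat (toMat z * A) ∈ E} ∂gaussMat m N := by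
  have hms := measurable_flat_mul (m := m) (N := N) hE
  have h1 := Measure.prod_apply (μ := gaussMat m N) (ν := μ) hms
  have h2 := Measure.prod_apply_symm (μ := gaussMat m N) (ν := μ) hms
  have h3 : ∀ᵐ A ∂μ, gaussMat m N ((fun z => (z, A)) ⁻¹'
      ((fun q : (Fin m × Fin N → ℝ) × Matrix (Fin N) (Fin N) ℝ => flat (toMat q.1 * q.2)) ⁻¹' E))
      = gaussMat m N E := by
    filter_upwards [ae_orthogonal hμ] with A hA
    conv_rhs => rw [← map_gaussMat_mul hA]
    have hf : Measurable fun z : Fin m × Fin N → ℝ => flat (toMat z * A) :=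
      measurable_flat_mul.comp measurable_prodMk_right
    rw [Measure.map_apply hf hE]
    rfl
  rw [lintegral_congr_ae h3, lintegral_const, measure_univ, mul_one, h1] at h2
  exact h2.symm

/-- The Gram matrix of the rows of `z` is within `δ` of `c ^ 2` times the identity. -/
def NearlyOrthogonal (c δ : ℝ) (z : Fin m × Fin N → ℝ) : Prop :=
  ‖(c ^ 2)⁻¹ • (toMat z * (toMat z)ᵀ) - 1‖ ≤ δ

lemma measurableSet_nearlyOrthogonal (c δ : ℝ) :
    MeasurableSet {z : Fin m × Fin N → ℝ | NearlyOrthogonal c δ z} := by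
  have h : Continuous (toMat : (Fin m × Fin N → ℝ) → Matrix (Fin m) (Fin N) ℝ) :=
    continuous_pi fun i => continuous_pi fun j => continuous_apply (i, j)
  have h1 : Continuous fun z : Fin m × Fin N → ℝ => toMat z * (toMat z)ᵀ :=
    h.matrix_mul h.matrix_transpose
  have h2 : Continuous fun M : Matrix (Fin m) (Fin m) ℝ => ‖(c ^ 2)⁻¹ • M - 1‖ := by fun_prop
  exact (isClosed_le (h2.comp h1) continuous_const).measurableSet

lemma exists_measure_mul_eq (hmN : m ≤ N)
    (hinv : ∀ B : Matrix (Fin N) (Fin N) ℝ, B * Bᵀ = 1 → μ.map (fun A => B * A) = μ)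
    {c δ : ℝ} (hc : 0 < c) (hδ : δ < 1) {E : Set (Fin m × Fin N → ℝ)} (hE : MeasurableSet E)
    {z : Fin m × Fin N → ℝ} (hz : NearlyOrthogonal c δ z) :
    ∃ S : Matrix (Fin m) (Fin m) ℝ, ‖S - 1‖ ≤ δ ∧ μ {A | flat (toMat z * A) ∈ E} =
      μ {A | flat (c • (S * A.submatrix (Fin.castLE hmN) id)) ∈ E} := by
  obtain ⟨S, hS, Q, hQ, hZ⟩ := exists_polar hmN hc (toMat z) hδ hz
  refine ⟨S, hS, ?_⟩
  conv_rhs => rw [← hinv Q hQ]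
  refine Eq.trans ?_ (Measure.map_apply (measurable_mul_left_matrix Q)
    (measurable_rows hmN c S hE)).symm
  congr 1
  ext A
  have : toMat z * A = c • (S * (Q * A).submatrix (Fin.castLE hmN) id) := by
    rw [hZ, Matrix.smul_mul, Matrix.mul_assoc]
    rfl
  simp [this]

/-- The Haar measure of `F` is controlled by the Gaussian measure of `E` when rescaling the first
rows of matrices in `F`, up to multiplication by a matrix near the identity, lands in `E`. -/
lemma measure_mul_le_gaussMat [IsProbabilityMeasure μ] (hmN : m ≤ N) (hμ : μ {A | A * Aᵀ = 1} = 1)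
    (hinv : ∀ B : Matrix (Fin N) (Fin N) ℝ, B * Bᵀ = 1 → μ.map (fun A => B * A) = μ)
    {c δ : ℝ} (hc : 0 < c) (hδ : δ < 1) {E : Set (Fin m × Fin N → ℝ)} (hE : MeasurableSet E)
    {F : Set (Matrix (Fin N) (Fin N) ℝ)}
    (hEF : ∀ (S : Matrix (Fin m) (Fin m) ℝ), ∀ A ∈ F, ‖S - 1‖ ≤ δ →
      flat (c • (S * A.submatrix (Fin.castLE hmN) id)) ∈ E) :
    μ F * gaussMat m N {z | NearlyOrthogonal c δ z} ≤ gaussMat m N E := by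
  rw [gaussMat_eq_lintegral hμ hE, ← setLIntegral_const]
  refine le_trans ?_ (setLIntegral_le_lintegral {z | NearlyOrthogonal c δ z} _)
  refine setLIntegral_mono' ?_ (fun z hz => ?_)
  · exact measurableSet_nearlyOrthogonal c δ
  · obtain ⟨S, hS, h⟩ := exists_measure_mul_eq hmN hinv hc hδ hE hz
    rw [h]
    exact measure_mono fun A hA => hEF S A hA hS

/-- Reverse comparison to `measure_mul_le_gaussMat`, for sets `E` of nearly orthogonal matrices. -/
lemma gaussMat_le_measure [IsProbabilityMeasure μ] (hmN : m ≤ N) (hμ : μ {A | A * Aᵀ = 1} = 1)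
    (hinv : ∀ B : Matrix (Fin N) (Fin N) ℝ, B * Bᵀ = 1 → μ.map (fun A => B * A) = μ)
    {c δ : ℝ} (hc : 0 < c) (hδ : δ < 1) {E : Set (Fin m × Fin N → ℝ)} (hE : MeasurableSet E)
    {F : Set (Matrix (Fin N) (Fin N) ℝ)} (hE' : ∀ z ∈ E, NearlyOrthogonal c δ z)
    (hEF : ∀ (S : Matrix (Fin m) (Fin m) ℝ) (A : Matrix (Fin N) (Fin N) ℝ), ‖S - 1‖ ≤ δ →
      flat (c • (S * A.submatrix (Fin.castLE hmN) id)) ∈ E → A ∈ F) :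
    gaussMat m N E ≤ μ F := by
  rw [gaussMat_eq_lintegral hμ hE]
  refine (lintegral_mono (g := fun _ => μ F) fun z => ?_).trans (by simp)
  by_cases hz : NearlyOrthogonal c δ z
  · obtain ⟨S, hS, h⟩ := exists_measure_mul_eq hmN hinv hc hδ hE hz
    change μ _ ≤ μ F
    rw [h]
    exact measure_mono fun A hA => hEF S A hS hA
  · have : μ {A | flat (toMat z * A) ∈ E} = 0 := by
      rw [measure_eq_zero_iff_ae_notMem]
      filter_upwards [ae_orthogonal hμ] with A hA hzA
      have := hE' _ hzA
      rw [NearlyOrthogonal, toMat_flat, Matrix.transpose_mul, Matrix.mul_assoc,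
        ← Matrix.mul_assoc A, hA, Matrix.one_mul] at this
      exact hz this
    change μ _ ≤ μ F
    rw [this]
    exact zero_le

end GaussianComparison

section GaussianEstimates

open ProbabilityTheory

/-- The law of a doubly indexed family of independent standard Gaussians. -/
noncomputable def gaussSeq (m : ℕ) : Measure (Fin m × ℕ → ℝ) :=
  Measure.infinitePi fun _ => gaussianReal 0 1

instance (m : ℕ) : IsProbabilityMeasure (gaussSeq m) := by
  unfold gaussSeq; infer_instance

variable {m : ℕ}

lemma measurable_coord (p : Fin m × ℕ) : Measurable fun ω : Fin m × ℕ → ℝ => ω p :=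
  measurable_pi_apply p

lemma map_gaussSeq_eval (p : Fin m × ℕ) : (gaussSeq m).map (fun ω => ω p) = gaussianReal 0 1 :=
  Measure.infinitePi_map_eval _ p

lemma iIndepFun_gaussSeq :
    iIndepFun (fun (p : Fin m × ℕ) (ω : Fin m × ℕ → ℝ) => ω p) (gaussSeq m) :=
  iIndepFun_infinitePi (X := fun _ x => x) fun _ => measurable_id

lemma gaussMat_apply {N : ℕ} {E : Set (Fin m × Fin N → ℝ)} (hE : MeasurableSet E) :
    gaussMat m N E =
      gaussSeq m {ω | (fun p : Fin m × Fin N => ω (p.1, (p.2 : ℕ))) ∈ E} := by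
  have hinj : Function.Injective fun p : Fin m × Fin N => (p.1, (p.2 : ℕ)) := by
    rintro ⟨a, b⟩ ⟨c, d⟩ h
    simpa [Fin.ext_iff] using h
  have := Measure.map_infinitePi_infinitePi_of_inj (P := fun _ : Fin m × ℕ => gaussianReal 0 1) hinj
  rw [Measure.infinitePi_eq_pi fun _ : Fin m × Fin N => gaussianReal 0 1] at this
  rw [gaussMat, ← this, Measure.map_apply (by fun_prop) hE]
  rfl

lemma memLp_gaussSeq_eval (p : Fin m × ℕ) : MemLp (fun ω => ω p) 2 (gaussSeq m) := by
  have h : MemLp id 2 ((gaussSeq m).map fun ω => ω p) := by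
    rw [map_gaussSeq_eval]
    exact memLp_id_gaussianReal 2
  exact h.comp_of_map (measurable_coord p).aemeasurable

lemma integral_gaussSeq_eval (p : Fin m × ℕ) : ∫ ω, ω p ∂gaussSeq m = 0 := by
  have := integral_map (μ := gaussSeq m) (φ := fun ω => ω p) (f := fun x : ℝ => x)
    (measurable_coord p).aemeasurable (by fun_prop)
  rw [← this, map_gaussSeq_eval, integral_id_gaussianReal]

lemma integral_gaussSeq_sq (p : Fin m × ℕ) : ∫ ω, ω p ^ 2 ∂gaussSeq m = 1 := by
  have := integral_map (μ := gaussSeq m) (φ := fun ω => ω p) (f := fun x : ℝ => x ^ 2)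
    (measurable_coord p).aemeasurable (by fun_prop)
  rw [← this, map_gaussSeq_eval]
  have h := variance_id_gaussianReal (μ := 0) (v := 1)
  rw [variance_eq_integral (by fun_prop)] at h
  simpa [integral_id_gaussianReal] using h

lemma integral_gaussSeq_mul (i i' : Fin m) (j : ℕ) :
    ∫ ω, ω (i, j) * ω (i', j) ∂gaussSeq m = (1 : Matrix (Fin m) (Fin m) ℝ) i i' := by
  by_cases h : i = i'
  · subst h
    simp only [← sq, integral_gaussSeq_sq, Matrix.one_apply_eq]
  · rw [Matrix.one_apply_ne h]
    have hind := (iIndepFun_gaussSeq (m := m)).indepFun (i := (i, j)) (j := (i', j)) (by simp [h])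
    have := hind.integral_mul_eq_mul_integral
      (measurable_coord _).aestronglyMeasurable (measurable_coord _).aestronglyMeasurable
    simpa [integral_gaussSeq_eval] using this

lemma ae_tendsto_gram (i i' : Fin m) : ∀ᵐ ω ∂gaussSeq m,
    Tendsto (fun N : ℕ => (∑ j ∈ Finset.range N, ω (i, j) * ω (i', j)) / (N : ℝ)) atTop
      (nhds ((1 : Matrix (Fin m) (Fin m) ℝ) i i')) := by
  let X : ℕ → (Fin m × ℕ → ℝ) → ℝ := fun j ω => ω (i, j) * ω (i', j)
  have hint : Integrable (X 0) (gaussSeq m) :=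
    (memLp_gaussSeq_eval (i, 0)).integrable_mul (memLp_gaussSeq_eval (i', 0))
  have hind : Pairwise (Function.onFun (fun Y Z => IndepFun Y Z (gaussSeq m)) X) := by
    intro j l hjl
    have h : ∀ a b : Fin m, (a, j) ≠ (b, l) := fun a b hab => hjl (Prod.ext_iff.1 hab).2
    exact (iIndepFun_gaussSeq (m := m)).indepFun_mul_mul measurable_coord (i, j) (i', j) (i, l)
      (i', l) (h _ _) (h _ _) (h _ _) (h _ _)
  have hX : ∀ j, Measurable (X j) := fun j => (measurable_coord _).mul (measurable_coord _)
  have hident : ∀ j, IdentDistrib (X j) (X 0) (gaussSeq m) (gaussSeq m) := by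
    intro j
    refine ⟨(hX j).aemeasurable, (hX 0).aemeasurable, ?_⟩
    have hinj : Function.Injective fun q : Fin m × ℕ => (q.1, q.2 + j) := by
      rintro ⟨a, b⟩ ⟨c, d⟩ h
      simpa using h
    have := Measure.map_infinitePi_infinitePi_of_inj
      (P := fun _ : Fin m × ℕ => gaussianReal 0 1) hinj
    change (gaussSeq m).map _ = gaussSeq m at this
    conv_rhs => rw [← this]
    rw [Measure.map_map (hX 0) (by fun_prop)]
    simp [Function.comp_def, X]
  have h := strong_law_ae_real X hint hind hident
  have h0 : ∫ ω, X 0 ω ∂gaussSeq m = (1 : Matrix (Fin m) (Fin m) ℝ) i i' :=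
    integral_gaussSeq_mul i i' 0
  rwa [h0] at h

/-- The Gram matrix of the columns from `k` on, normalised by `N`, is entrywise within `η` of the
identity. -/
def gramTail (m k N : ℕ) (η : ℝ) : Set (Fin m × ℕ → ℝ) :=
  {ω | ∀ i i', |(∑ j ∈ Finset.Ico k N, ω (i, j) * ω (i', j)) / (N : ℝ) -
    (1 : Matrix (Fin m) (Fin m) ℝ) i i'| ≤ η}

lemma eventually_half_le_gramTail (k : ℕ) {η : ℝ} (hη : 0 < η) :
    ∀ᶠ N in atTop, 2⁻¹ ≤ gaussSeq m (gramTail m k N η) := by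
  let f : ℕ → (Fin m × ℕ → ℝ) → Fin m → Fin m → ℝ := fun N ω i i' =>
    (∑ j ∈ Finset.Ico k N, ω (i, j) * ω (i', j)) / (N : ℝ)
  have hf : ∀ N, Measurable (f N) := fun N => by
    refine measurable_pi_lambda _ fun i => measurable_pi_lambda _ fun i' => ?_
    fun_prop
  have hlim : ∀ᵐ ω ∂gaussSeq m, Tendsto (fun N => f N ω) atTop
      (nhds (fun i i' => (1 : Matrix (Fin m) (Fin m) ℝ) i i')) := by
    have h : ∀ᵐ ω ∂gaussSeq m, ∀ i i',
        Tendsto (fun N : ℕ => (∑ j ∈ Finset.range N, ω (i, j) * ω (i', j)) / (N : ℝ)) atTop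
          (nhds ((1 : Matrix (Fin m) (Fin m) ℝ) i i')) := by
      simp only [ae_all_iff]
      exact ae_tendsto_gram
    filter_upwards [h] with ω hω
    refine tendsto_pi_nhds.2 fun i => tendsto_pi_nhds.2 fun i' => ?_
    have h0 := tendsto_const_div_atTop_nhds_zero_nat (∑ j ∈ Finset.range k, ω (i, j) * ω (i', j))
    have := (hω i i').sub h0
    rw [sub_zero] at this
    refine this.congr' ?_
    filter_upwards [eventually_ge_atTop k] with N hN
    simp only [f]
    rw [Finset.sum_Ico_eq_sub _ hN, sub_div]
  have hm := tendstoInMeasure_of_tendsto_ae (fun N => (hf N).aestronglyMeasurable) hlim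
  have h0 := (ENNReal.tendsto_nhds_zero.1 (hm (ENNReal.ofReal η) (by simpa using hη))) 2⁻¹ (by simp)
  filter_upwards [h0] with N hN
  have hsub : (gramTail m k N η)ᶜ ⊆ {ω | ENNReal.ofReal η ≤
      edist (f N ω) (fun i i' => (1 : Matrix (Fin m) (Fin m) ℝ) i i')} := by
    intro ω hω
    by_contra hlt
    apply hω
    have hlt : edist (f N ω) (fun i i' => (1 : Matrix (Fin m) (Fin m) ℝ) i i') <
      ENNReal.ofReal η := not_le.1 hlt
    rw [edist_dist, ENNReal.ofReal_lt_ofReal_iff hη] at hlt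
    intro i i'
    rw [← Real.dist_eq]
    exact ((dist_le_pi_dist (f N ω i) _ i').trans (dist_le_pi_dist (f N ω) _ i)).trans hlt.le
  have h1 : gaussSeq m (gramTail m k N η)ᶜ ≤ 2⁻¹ := (measure_mono hsub).trans hN
  have h2 : 1 ≤ gaussSeq m (gramTail m k N η) + gaussSeq m (gramTail m k N η)ᶜ := by
    rw [← measure_univ (μ := gaussSeq m), ← Set.union_compl_self (gramTail m k N η)]
    exact measure_union_le _ _
  have h3 : (1 : ENNReal) ≤ gaussSeq m (gramTail m k N η) + 2⁻¹ := h2.trans (by gcongr)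
  rw [← ENNReal.inv_two_add_inv_two] at h3
  exact (ENNReal.add_le_add_iff_right (by simp)).1 h3

lemma integrable_exp_sq_gaussianReal {t : ℝ} (ht : t < 1 / 2) :
    Integrable (fun x => Real.exp (t * x ^ 2)) (gaussianReal 0 1) := by
  rw [gaussianReal_of_var_ne_zero _ one_ne_zero, integrable_withDensity_iff
    (measurable_gaussianPDF 0 1) (.of_forall fun x => gaussianPDF_lt_top)]
  have := (integrable_exp_neg_mul_sq (b := 1 / 2 - t) (by linarith)).const_mul
    (Real.sqrt (2 * Real.pi))⁻¹
  refine this.congr (.of_forall fun x => ?_)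
  simp only [toReal_gaussianPDF, gaussianPDFReal]
  rw [mul_left_comm, ← Real.exp_add]
  simp only [NNReal.coe_one, mul_one]
  congr 2
  ring

/-- Chernoff bound for a chi-square variable. -/
lemma gaussSeq_sum_sq_ge_le (T : Finset (Fin m × ℕ)) {t : ℝ} (ht0 : 0 ≤ t) (ht : t < 1 / 2) :
    ∃ K : ℝ, 0 < K ∧ ∀ u : ℝ, gaussSeq m {ω | u ≤ ∑ p ∈ T, ω p ^ 2} ≤
      ENNReal.ofReal (K * Real.exp (-t * u)) := by
  have hind : iIndepFun (fun (p : Fin m × ℕ) (ω : Fin m × ℕ → ℝ) => ω p ^ 2) (gaussSeq m) :=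
    iIndepFun_gaussSeq.comp (fun _ x => x ^ 2) fun _ => by fun_prop
  have hint : ∀ p : Fin m × ℕ, Integrable (fun ω => Real.exp (t * ω p ^ 2)) (gaussSeq m) := by
    intro p
    have h := integrable_exp_sq_gaussianReal ht
    rw [← map_gaussSeq_eval p] at h
    exact h.comp_measurable (by fun_prop)
  have hsum := hind.integrable_exp_mul_sum (s := T) (fun _ => by fun_prop) fun p _ => hint p
  refine ⟨mgf (∑ p ∈ T, fun ω : Fin m × ℕ → ℝ => ω p ^ 2) (gaussSeq m) t, mgf_pos hsum,
    fun u => ?_⟩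
  have := measure_ge_le_exp_mul_mgf u ht0 hsum
  rw [measureReal_def, mul_comm] at this
  simp only [Finset.sum_apply] at this
  exact (ENNReal.le_ofReal_iff_toReal_le (measure_ne_top _ _) (by
    have := mgf_nonneg (X := ∑ p ∈ T, fun ω : Fin m × ℕ → ℝ => ω p ^ 2) (μ := gaussSeq m) (t := t)
    positivity)).2 this

lemma le_gaussianReal_ball {s ε a : ℝ} (hs : 0 < s) (hsε : s ≤ ε) :
    ENNReal.ofReal (2 * (Real.sqrt (2 * Real.pi))⁻¹ * Real.exp (-(|a| / s + 1) ^ 2 / 2)) ≤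
      gaussianReal 0 1 {x | |s * x - a| < ε} := by
  have hsub : Set.Ioo (a / s - 1) (a / s + 1) ⊆ {x | |s * x - a| < ε} := by
    intro x hx
    have h1 : |x - a / s| < 1 := abs_lt.2 ⟨by linarith [hx.1], by linarith [hx.2]⟩
    have h2 : s * x - a = s * (x - a / s) := by field_simp
    change |s * x - a| < ε
    rw [h2, abs_mul, abs_of_pos hs]
    nlinarith
  refine le_trans ?_ (measure_mono hsub)
  rw [gaussianReal_apply _ one_ne_zero]
  have hle : ∀ x ∈ Set.Ioo (a / s - 1) (a / s + 1),
      ENNReal.ofReal ((Real.sqrt (2 * Real.pi))⁻¹ * Real.exp (-(|a| / s + 1) ^ 2 / 2)) ≤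
        gaussianPDF 0 1 x := by
    intro x hx
    rw [gaussianPDF_def]
    refine ENNReal.ofReal_le_ofReal ?_
    simp only [gaussianPDFReal, NNReal.coe_one, mul_one, sub_zero]
    have h1 : |x - a / s| < 1 := abs_lt.2 ⟨by linarith [hx.1], by linarith [hx.2]⟩
    have h2 : |x| ≤ |x - a / s| + |a / s| := by
      simpa using abs_add_le (x - a / s) (a / s)
    rw [abs_div, abs_of_pos hs] at h2
    have h3 : |x| ^ 2 ≤ (|a| / s + 1) ^ 2 := pow_le_pow_left₀ (abs_nonneg x) (by linarith) 2
    rw [sq_abs] at h3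
    exact mul_le_mul_of_nonneg_left (Real.exp_le_exp.2 (by linarith)) (by positivity)
  refine le_trans (le_of_eq ?_) (setLIntegral_mono' measurableSet_Ioo hle)
  rw [setLIntegral_const, Real.volume_Ioo, ← ENNReal.ofReal_mul (by positivity)]
  congr 1
  ring

lemma le_gaussSeq_ball_inter_gramTail (k N : ℕ) (η : ℝ) {s ε : ℝ} (hs : 0 < s) (hsε : s ≤ ε)
    (a : Fin m × ℕ → ℝ) :
    (∏ p ∈ Finset.univ ×ˢ Finset.range k, ENNReal.ofReal
      (2 * (Real.sqrt (2 * Real.pi))⁻¹ * Real.exp (-(|a p| / s + 1) ^ 2 / 2))) *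
        gaussSeq m (gramTail m k N η) ≤
    gaussSeq m ({ω | ∀ p ∈ Finset.univ ×ˢ Finset.range k, |s * ω p - a p| < ε} ∩
      gramTail m k N η) := by
  let T : Finset (Fin m × ℕ) := Finset.univ ×ˢ Finset.range k
  let T' : Finset (Fin m × ℕ) := Finset.univ ×ˢ Finset.Ico k N
  have hdisj : Disjoint T T' := by
    rw [Finset.disjoint_left]
    rintro ⟨i, j⟩ h h'
    simp only [T, T', Finset.mem_product, Finset.mem_univ, Finset.mem_range, Finset.mem_Ico,
      true_and] at h h'
    omega
  have hind := iIndepFun_gaussSeq.indepFun_finset T T' hdisj (by fun_prop)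
  have hT' : ∀ (i : Fin m) (j : Finset.Ico k N), (i, (j : ℕ)) ∈ T' := fun i j => by
    simp [T']
  let A : Set (T → ℝ) := {x | ∀ p : T, |s * x p - a p| < ε}
  let B : Set (T' → ℝ) := {x | ∀ i i',
    |(∑ j : Finset.Ico k N, x ⟨(i, j), hT' i j⟩ * x ⟨(i', j), hT' i' j⟩) / N -
      (1 : Matrix (Fin m) (Fin m) ℝ) i i'| ≤ η}
  have hA : MeasurableSet A := by
    have : A = ⋂ p : T, {x : T → ℝ | |s * x p - a p| < ε} :=
      Set.ext fun x => by simp only [Set.mem_iInter]; rfl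
    rw [this]
    exact MeasurableSet.iInter fun p => measurableSet_lt (by fun_prop) (by fun_prop)
  have hB : MeasurableSet B := by
    have : B = ⋂ i, ⋂ i', {x | |(∑ j : Finset.Ico k N, x ⟨(i, j), hT' i j⟩ *
        x ⟨(i', j), hT' i' j⟩) / N - (1 : Matrix (Fin m) (Fin m) ℝ) i i'| ≤ η} :=
      Set.ext fun x => by simp only [Set.mem_iInter]; rfl
    rw [this]
    exact MeasurableSet.iInter fun i => MeasurableSet.iInter fun i' =>
      measurableSet_le (by fun_prop) (by fun_prop)
  have h := hind.measure_inter_preimage_eq_mul A B hA hB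
  have hAe : (fun (ω : Fin m × ℕ → ℝ) (p : T) => ω p) ⁻¹' A =
      {ω | ∀ p ∈ T, |s * ω p - a p| < ε} := by
    refine Set.ext fun ω => ⟨fun h p hp => h ⟨p, hp⟩, fun h p => h p p.2⟩
  have hBe : (fun (ω : Fin m × ℕ → ℝ) (p : T') => ω p) ⁻¹' B = gramTail m k N η := by
    refine Set.ext fun ω => forall_congr' fun i => forall_congr' fun i' => ?_
    rw [← Finset.sum_coe_sort (Finset.Ico k N)]
  rw [hAe, hBe] at h
  rw [h]
  gcongr
  have hprod := iIndepFun_gaussSeq.measure_inter_preimage_eq_mul T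
    (sets := fun p => {x | |s * x - a p| < ε}) fun p _ =>
      measurableSet_lt (by fun_prop) (by fun_prop)
  have hset : ⋂ p ∈ T, (fun ω : Fin m × ℕ → ℝ => ω p) ⁻¹' {x | |s * x - a p| < ε} =
      {ω | ∀ p ∈ T, |s * ω p - a p| < ε} := Set.ext fun ω => by
    simp only [Set.mem_iInter]; rfl
  rw [← hset, hprod]
  refine Finset.prod_le_prod' fun p _ => ?_
  rw [← Measure.map_apply (measurable_coord p) (measurableSet_lt (by fun_prop) (by fun_prop)),
    map_gaussSeq_eval]
  exact le_gaussianReal_ball hs hsε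

end GaussianEstimates

section StiefelDeviations

open scoped Matrix.Norms.Frobenius

variable {m : ℕ}

lemma rowsEmb_apply {N : ℕ} (hmN : m ≤ N) (M : Matrix (Fin N) (Fin N) ℝ) (i : Fin m) {j : ℕ}
    (hj : j < N) : rowsEmb m M i j = M (Fin.castLE hmN i) ⟨j, hj⟩ :=
  dif_pos ⟨i.2.trans_le hmN, hj⟩

lemma sum_sq_rowsEmb {N k : ℕ} (hmN : m ≤ N) (hkN : k ≤ N) (b : ℝ)
    (M : Matrix (Fin N) (Fin N) ℝ) :
    ∑ p ∈ Finset.univ ×ˢ Finset.range k, (b * rowsEmb m M p.1 p.2) ^ 2 =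
      b ^ 2 * ‖M.submatrix (Fin.castLE hmN) (Fin.castLE hkN)‖ ^ 2 := by
  rw [frobenius_norm_sq, Finset.sum_product, Finset.mul_sum]
  refine Finset.sum_congr rfl fun i _ => ?_
  rw [Finset.sum_range, Finset.mul_sum]
  refine Finset.sum_congr rfl fun j _ => ?_
  rw [rowsEmb_apply hmN M i (j.2.trans_le hkN), mul_pow]
  rfl

lemma nearlyOrthogonal_of_abs_le {N : ℕ} {ω : Fin m × ℕ → ℝ} {η δ : ℝ} (hη : 0 ≤ η)
    (hδ : m * η ≤ δ)
    (h : ∀ i i', |(∑ j ∈ Finset.range N, ω (i, j) * ω (i', j)) / (N : ℝ) -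
      (1 : Matrix (Fin m) (Fin m) ℝ) i i'| ≤ η) :
    NearlyOrthogonal (Real.sqrt N) δ fun p : Fin m × Fin N => ω (p.1, (p.2 : ℕ)) := by
  refine (frobenius_norm_le_of_abs_le _ hη fun i i' => ?_).trans (by simpa using hδ)
  convert h i i' using 2
  rw [Finset.sum_range, Real.sq_sqrt (Nat.cast_nonneg N)]
  simp [toMat, Matrix.mul_apply, div_eq_inv_mul]

lemma eventually_half_le_nearlyOrthogonal {δ : ℝ} (hδ : 0 < δ) :
    ∀ᶠ N : ℕ in atTop, 2⁻¹ ≤ gaussMat m N {z | NearlyOrthogonal (Real.sqrt N) δ z} := by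
  have hη : 0 < δ / (m + 1) := by positivity
  filter_upwards [eventually_half_le_gramTail (m := m) 0 hη] with N hN
  rw [gaussMat_apply (measurableSet_nearlyOrthogonal _ _)]
  refine hN.trans (measure_mono fun ω hω => nearlyOrthogonal_of_abs_le hη.le ?_ ?_)
  · rw [mul_div_assoc', div_le_iff₀ (by positivity)]
    nlinarith
  · intro i i'
    have := hω i i'
    rwa [← Finset.range_eq_Ico] at this

/-- Upper tail of the squared norm of a rescaled corner of a Haar orthogonal matrix. -/
lemma eventually_measure_sum_sq_le (k : ℕ) (α : ℝ) {δ : ℝ} (hδ0 : 0 < δ) (hδ : δ < 1) :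
    ∃ K : ℝ, 0 < K ∧ ∀ᶠ N : ℕ in atTop, ∀ (μ : Measure (Matrix (Fin N) (Fin N) ℝ))
      [IsProbabilityMeasure μ], μ {A | A * Aᵀ = 1} = 1 →
      (∀ B : Matrix (Fin N) (Fin N) ℝ, B * Bᵀ = 1 → μ.map (fun A => B * A) = μ) →
      ∀ b : ℝ, 0 < b →
        μ {M | 2 * α ≤ ∑ p ∈ Finset.univ ×ˢ Finset.range k, (b * rowsEmb m M p.1 p.2) ^ 2} ≤
          ENNReal.ofReal (K * Real.exp (-((1 - δ) ^ 3 * α) * (N / b ^ 2))) := by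
  obtain ⟨K, hK, hKu⟩ := gaussSeq_sum_sq_ge_le (m := m) (Finset.univ ×ˢ Finset.range k)
    (t := (1 - δ) / 2) (by linarith) (by linarith)
  refine ⟨2 * K, by positivity, ?_⟩
  filter_upwards [eventually_half_le_nearlyOrthogonal (m := m) hδ0, eventually_ge_atTop m,
    eventually_ge_atTop k, eventually_ge_atTop 1] with N hN hmN hkN hN1 μ _ hμ hinv b hb
  have hN0 : (0 : ℝ) < N := by exact_mod_cast hN1
  let u : ℝ := N * (1 - δ) ^ 2 * (2 * α) / b ^ 2
  let E : Set (Fin m × Fin N → ℝ) :=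
    {z | u ≤ ∑ i, ∑ j : Fin k, z (i, Fin.castLE hkN j) ^ 2}
  have hE : MeasurableSet E := measurableSet_le (by fun_prop) (by fun_prop)
  have hcmp := measure_mul_le_gaussMat (E := E)
    (F := {M | 2 * α ≤ ∑ p ∈ Finset.univ ×ˢ Finset.range k, (b * rowsEmb m M p.1 p.2) ^ 2})
    hmN hμ hinv (Real.sqrt_pos.2 hN0) hδ hE (by
      intro S A hA hS
      change 2 * α ≤ _ at hA
      rw [sum_sq_rowsEmb hmN hkN] at hA
      have h1 := (norm_le_norm_mul_of_near_one hS
        (A.submatrix (Fin.castLE hmN) (Fin.castLE hkN))).1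
      have h2 : ∑ i, ∑ j : Fin k, flat (Real.sqrt N • (S * A.submatrix (Fin.castLE hmN) id))
          (i, Fin.castLE hkN j) ^ 2 =
          N * ‖S * A.submatrix (Fin.castLE hmN) (Fin.castLE hkN)‖ ^ 2 := by
        rw [frobenius_norm_sq, Finset.mul_sum]
        refine Finset.sum_congr rfl fun i _ => ?_
        rw [Finset.mul_sum]
        refine Finset.sum_congr rfl fun j _ => ?_
        simp [flat, Matrix.mul_apply, mul_pow]
      change u ≤ _
      rw [h2]
      have h3 := pow_le_pow_left₀ (mul_nonneg (by linarith) (norm_nonneg _)) h1 2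
      refine le_trans ?_ (mul_le_mul_of_nonneg_left h3 hN0.le)
      rw [div_le_iff₀ (by positivity), mul_pow]
      have h4 := mul_le_mul_of_nonneg_left hA (by positivity : 0 ≤ N * (1 - δ) ^ 2)
      linarith)
  rw [gaussMat_apply hE] at hcmp
  have hset : {ω : Fin m × ℕ → ℝ | (fun p : Fin m × Fin N => ω (p.1, (p.2 : ℕ))) ∈ E} =
      {ω | u ≤ ∑ p ∈ Finset.univ ×ˢ Finset.range k, ω p ^ 2} := by
    refine Set.ext fun ω => ?_
    change u ≤ _ ↔ u ≤ _
    rw [Finset.sum_product]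
    simp only [Finset.sum_range, Fin.val_castLE]
  rw [hset] at hcmp
  have hfin := ((mul_le_mul_right hN _).trans hcmp).trans (hKu u)
  rw [← div_eq_mul_inv, ENNReal.div_le_iff (by simp) (by simp)] at hfin
  refine hfin.trans (le_of_eq ?_)
  rw [← ENNReal.ofReal_ofNat 2, ← ENNReal.ofReal_mul (by positivity)]
  congr 1
  have : -((1 - δ) / 2) * u = -((1 - δ) ^ 3 * α) * (N / b ^ 2) := by
    simp only [u]
    ring
  rw [this]
  ring

/-- Lower bound for the probability that a rescaled Haar orthogonal matrix is entrywise close, on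
its corner, to a prescribed matrix. -/
lemma eventually_le_measure_cylinder {β : ℕ → ℝ} (hβ_pos : ∀ N, 0 < β N)
    (hβ_top : Tendsto β atTop atTop)
    (hs : Tendsto (fun N : ℕ => β N / Real.sqrt N) atTop (nhds 0)) (k : ℕ) (a : Fin m × ℕ → ℝ)
    {ε : ℝ} (hε : 0 < ε) :
    ∀ᶠ N : ℕ in atTop, ∀ (μ : Measure (Matrix (Fin N) (Fin N) ℝ))
      [IsProbabilityMeasure μ], μ {A | A * Aᵀ = 1} = 1 →
      (∀ B : Matrix (Fin N) (Fin N) ℝ, B * Bᵀ = 1 → μ.map (fun A => B * A) = μ) →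
      (∏ p ∈ Finset.univ ×ˢ Finset.range k, ENNReal.ofReal (2 * (Real.sqrt (2 * Real.pi))⁻¹ *
        Real.exp (-(|a p| / (β N / Real.sqrt N) + 1) ^ 2 / 2))) * 2⁻¹ ≤
        μ {M | ∀ p ∈ Finset.univ ×ˢ Finset.range k, |β N * rowsEmb m M p.1 p.2 - a p| < ε} := by
  let T : Finset (Fin m × ℕ) := Finset.univ ×ˢ Finset.range k
  let B : ℝ := ε / 2 + ∑ p ∈ T, |a p|
  have hB : 0 < B := by positivity
  let L : ℝ := Real.sqrt (m * (k * B ^ 2))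
  have hL : 0 ≤ L := Real.sqrt_nonneg _
  let δ : ℝ := min (1 / 2) (ε / (4 * (L + 1)))
  have hδ0 : 0 < δ := lt_min (by norm_num) (by positivity)
  have hδ2 : δ ≤ 1 / 2 := min_le_left _ _
  have hδL : 2 * δ * L < ε / 2 := by
    have h : δ * (4 * (L + 1)) ≤ ε := (le_div_iff₀ (by positivity)).1 (min_le_right _ _)
    nlinarith
  let η : ℝ := δ / (2 * (m + 1))
  have hη : 0 < η := by positivity
  have hηδ : m * (2 * η) ≤ δ := by
    have : 2 * η * (m + 1) = δ := by simp only [η]; field_simp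
    nlinarith
  have hbeta : ∀ᶠ N in atTop, k * B ^ 2 / β N ^ 2 ≤ η := by
    have h := ((tendsto_pow_atTop (two_ne_zero)).comp hβ_top).const_div_atTop (k * B ^ 2)
    exact h.eventually (eventually_le_nhds hη)
  filter_upwards [eventually_half_le_gramTail (m := m) k hη, eventually_ge_atTop m,
    eventually_ge_atTop k, eventually_ge_atTop 1, hbeta,
    hs.eventually (eventually_le_nhds (half_pos hε))] with N hN hmN hkN hN1 hbN hsN μ _ hμ hinv
  have hN0 : (0 : ℝ) < N := by exact_mod_cast hN1
  have hc : 0 < Real.sqrt N := Real.sqrt_pos.2 hN0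
  set s : ℝ := β N / Real.sqrt N with hs_def
  have hs0 : 0 < s := div_pos (hβ_pos N) hc
  have hsc : s * Real.sqrt N = β N := div_mul_cancel₀ _ hc.ne'
  have hBa : ∀ p ∈ T, ∀ x : ℝ, |x - a p| < ε / 2 → |x| ≤ B := by
    intro p hp x hx
    have h1 : |x| ≤ |x - a p| + |a p| := by simpa using abs_add_le (x - a p) (a p)
    have h2 := Finset.single_le_sum (f := fun p => |a p|) (fun p _ => abs_nonneg _) hp
    simp only [B]
    linarith
  have hT : ∀ (i : Fin m) (j : Fin k), (i, (j : ℕ)) ∈ T := fun i j => by simp [T]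
  let E : Set (Fin m × Fin N → ℝ) :=
    {z | ∀ (i : Fin m) (j : Fin k), |s * z (i, Fin.castLE hkN j) - a (i, j)| < ε / 2} ∩
      {z | NearlyOrthogonal (Real.sqrt N) δ z}
  have hE : MeasurableSet E := by
    refine MeasurableSet.inter ?_ (measurableSet_nearlyOrthogonal _ _)
    simp only [Set.ofPred_forall]
    exact MeasurableSet.iInter fun i => MeasurableSet.iInter fun j =>
      measurableSet_lt (by fun_prop) (by fun_prop)
  have hcmp := gaussMat_le_measure (E := E)
    (F := {M | ∀ p ∈ T, |β N * rowsEmb m M p.1 p.2 - a p| < ε})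
    hmN hμ hinv hc (hδ2.trans_lt (by norm_num)) hE (fun z hz => hz.2) (by
      intro S A hS hz
      let W : Matrix (Fin m) (Fin k) ℝ := A.submatrix (Fin.castLE hmN) (Fin.castLE hkN)
      have hz1 : ∀ (i : Fin m) (j : Fin k), |β N * (S * W) i j - a (i, j)| < ε / 2 := by
        intro i j
        have := hz.1 i j
        have heq : s * flat (Real.sqrt N • (S * A.submatrix (Fin.castLE hmN) id))
            (i, Fin.castLE hkN j) = β N * (S * W) i j := by
          rw [← hsc, mul_assoc]
          rfl
        rwa [heq] at this
      have hnorm : ‖β N • (S * W)‖ ≤ L := by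
        refine Real.le_sqrt_of_sq_le ?_
        rw [frobenius_norm_sq]
        have h : ∀ i j, (β N • (S * W)) i j ^ 2 ≤ B ^ 2 := fun i j =>
          sq_le_sq.2 ((hBa _ (hT i j) _ (hz1 i j)).trans (le_abs_self B))
        refine (Finset.sum_le_sum fun i _ => Finset.sum_le_sum fun j _ => h i j).trans ?_
        simp
      have hmul : β N • (S * W) = S * (β N • W) := (Matrix.mul_smul _ _ _).symm
      obtain ⟨h1, h2⟩ := norm_le_norm_mul_of_near_one hS (β N • W)
      rw [← hmul] at h1 h2
      have hn0 := norm_nonneg (β N • W)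
      have h3 : ‖β N • (S * W) - β N • W‖ < ε / 2 := by
        have h4 : ‖β N • W‖ ≤ 2 * L := by nlinarith
        nlinarith
      rintro ⟨i, j⟩ hp
      have hj : j < k := by simpa [T] using hp
      have h5 := (abs_apply_le_frobenius_norm _ i ⟨j, hj⟩).trans_lt h3
      have h6 := hz1 i ⟨j, hj⟩
      change |β N * rowsEmb m A i j - a (i, j)| < ε
      rw [rowsEmb_apply hmN A i (hj.trans_le hkN)]
      have h7 : |β N * (S * W) i ⟨j, hj⟩ -
          β N * A (Fin.castLE hmN i) ⟨j, hj.trans_le hkN⟩| < ε / 2 := h5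
      rw [abs_lt] at h6 h7 ⊢
      simp only at h6
      constructor <;> linarith [h6.1, h6.2, h7.1, h7.2])
  refine le_trans ?_ hcmp
  rw [gaussMat_apply hE]
  have hcore := le_gaussSeq_ball_inter_gramTail k N η hs0 hsN a
  refine (mul_le_mul_right hN _).trans (hcore.trans (measure_mono ?_))
  rintro ω ⟨h1, h2⟩
  refine ⟨fun i j => h1 _ (hT i j), nearlyOrthogonal_of_abs_le (by positivity) hηδ fun i i' => ?_⟩
  have hω : ∀ (i : Fin m), ∀ j ∈ Finset.range k, |ω (i, j)| ≤ B / s := by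
    intro i j hj
    have hp : (i, j) ∈ T := by simpa [T] using hj
    have := hBa _ hp _ (h1 _ hp)
    rw [abs_mul, abs_of_pos hs0] at this
    rw [le_div_iff₀ hs0]
    linarith
  have h3 : |∑ j ∈ Finset.range k, ω (i, j) * ω (i', j)| ≤ k * (B / s) ^ 2 := by
    refine (Finset.abs_sum_le_sum_abs _ _).trans ?_
    refine (Finset.sum_le_card_nsmul _ _ ((B / s) ^ 2) fun j hj => ?_).trans (by simp)
    rw [abs_mul, sq]
    exact mul_le_mul (hω i j hj) (hω i' j hj) (abs_nonneg _) (by positivity)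
  have h4 : |(∑ j ∈ Finset.range k, ω (i, j) * ω (i', j)) / (N : ℝ)| ≤ η := by
    rw [abs_div, abs_of_pos hN0]
    refine (div_le_div_of_nonneg_right h3 hN0.le).trans (le_trans (le_of_eq ?_) hbN)
    rw [hs_def, div_div_eq_mul_div, div_pow, mul_pow, Real.sq_sqrt hN0.le]
    have := (hβ_pos N).ne'
    field_simp
  have h5 := h2 i i'
  rw [← Finset.sum_range_add_sum_Ico _ hkN, add_div, add_sub_assoc, two_mul]
  exact (abs_add_le _ _).trans (add_le_add h4 h5)

lemma rateI_le_of_forall_sum_le {A : Fin m → ℕ → ℝ} {c : ℝ}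
    (h : ∀ k, ∑ p ∈ Finset.univ ×ˢ Finset.range k, A p.1 p.2 ^ 2 ≤ 2 * c) : rateI m A ≤ c := by
  have hfin : ∀ u : Finset (Fin m × ℕ), ∑ p ∈ u, A p.1 p.2 ^ 2 ≤ 2 * c := by
    intro u
    refine (Finset.sum_le_sum_of_subset_of_nonneg ?_ fun p _ _ => sq_nonneg _).trans
      (h (u.sup Prod.snd + 1))
    intro p hp
    simpa [Nat.lt_succ_iff] using Finset.le_sup (f := Prod.snd) hp
  have hsum : Summable fun p : Fin m × ℕ => A p.1 p.2 ^ 2 :=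
    summable_of_sum_le (fun p => sq_nonneg _) hfin
  rw [rateI, if_pos hsum, EReal.coe_le_coe_iff]
  linarith [hsum.tsum_le_of_sum_le hfin]

lemma half_sum_le_rateI (A : Fin m → ℕ → ℝ) (T : Finset (Fin m × ℕ)) :
    ((1 / 2 * ∑ p ∈ T, A p.1 p.2 ^ 2 : ℝ) : EReal) ≤ rateI m A := by
  rw [rateI]
  split_ifs with hsum
  · rw [EReal.coe_le_coe_iff]
    exact mul_le_mul_of_nonneg_left (hsum.sum_le_tsum T fun p _ => sq_nonneg _) (by norm_num)
  · exact le_top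

/-- On a closed set, a lower bound on the rate function is witnessed by a finite truncation. -/
lemma exists_forall_le_sum_of_lt_iInf_rateI {C : Set (Fin m → ℕ → ℝ)} (hC : IsClosed C) {α : ℝ}
    (hα : (α : EReal) < ⨅ A ∈ C, rateI m A) :
    ∃ k, ∀ A ∈ C, 2 * α ≤ ∑ p ∈ Finset.univ ×ˢ Finset.range k, A p.1 p.2 ^ 2 := by
  by_contra! h
  choose A hAC hA using h
  have hle : ∀ k l, k ≤ l →
      ∑ p ∈ Finset.univ ×ˢ Finset.range k, A l p.1 p.2 ^ 2 ≤ 2 * α := fun k l hkl =>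
    (Finset.sum_le_sum_of_subset_of_nonneg
      (Finset.product_subset_product_right (Finset.range_mono hkl))
      fun p _ _ => sq_nonneg _).trans (hA l).le
  let U : Ultrafilter ℕ := hyperfilter ℕ
  have hU : (U : Filter ℕ) ≤ atTop := Nat.hyperfilter_le_atTop
  have hcoord : ∀ i j, ∃ x, Tendsto (fun l => A l i j) U (nhds x) := by
    intro i j
    have hev : ∀ᶠ l in (U : Filter ℕ), A l i j ∈ Set.Icc (-(|2 * α| + 1)) (|2 * α| + 1) := by
      filter_upwards [hU (eventually_ge_atTop (j + 1))] with l hl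
      have h1 := Finset.single_le_sum (f := fun p : Fin m × ℕ => A l p.1 p.2 ^ 2)
        (s := Finset.univ ×ˢ Finset.range (j + 1)) (fun p _ => sq_nonneg _) (a := (i, j))
        (by simp)
      have h2 := h1.trans ((hle (j + 1) l hl).trans (le_abs_self _))
      have h3 := abs_nonneg (2 * α)
      refine abs_le.1 (abs_le_of_sq_le_sq ?_ (by positivity))
      simp only at h2
      nlinarith
    obtain ⟨x, -, hx⟩ := isCompact_Icc.ultrafilter_le_nhds (U.map fun l => A l i j)
      (le_principal_iff.2 hev)
    exact ⟨x, hx⟩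
  choose x hx using hcoord
  have hlim : Tendsto A U (nhds x) :=
    tendsto_pi_nhds.2 fun i => tendsto_pi_nhds.2 fun j => hx i j
  have hxC : x ∈ C := hC.mem_of_tendsto hlim (.of_forall hAC)
  have hx' : rateI m x ≤ α := by
    refine rateI_le_of_forall_sum_le fun k => ?_
    refine le_of_tendsto (tendsto_finsetSum _ fun p _ => (hx p.1 p.2).pow 2) ?_
    filter_upwards [hU (eventually_ge_atTop k)] with l hl using hle k l hl
  exact (hα.trans_le (iInf₂_le x hxC)).not_ge hx'

/-- Every neighbourhood in the product topology contains a cylinder over a corner. -/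
lemma exists_cylinder_subset {O : Set (Fin m → ℕ → ℝ)} (hO : IsOpen O) {A : Fin m → ℕ → ℝ}
    (hA : A ∈ O) : ∃ (k : ℕ) (ε : ℝ), 0 < ε ∧ ∀ B : Fin m → ℕ → ℝ,
      (∀ p ∈ Finset.univ ×ˢ Finset.range k, |B p.1 p.2 - A p.1 p.2| < ε) → B ∈ O := by
  by_contra! h
  choose B hB hBO using fun k : ℕ => h k (1 / ((k : ℝ) + 1)) (by positivity)
  have hlim : Tendsto B atTop (nhds A) := by
    refine tendsto_pi_nhds.2 fun i => tendsto_pi_nhds.2 fun j => ?_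
    rw [tendsto_iff_dist_tendsto_zero]
    refine squeeze_zero' (.of_forall fun _ => dist_nonneg) ?_
      (tendsto_one_div_add_atTop_nhds_zero_nat (𝕜 := ℝ))
    filter_upwards [eventually_gt_atTop j] with l hl
    rw [Real.dist_eq]
    exact (hB l (i, j) (by simpa using hl)).le
  obtain ⟨l, hl⟩ := (hlim.eventually (hO.mem_nhds hA)).exists
  exact hBO l hl

lemma le_liminf_mul_log {v f : ℕ → ℝ} {P : ℕ → ENNReal} {l : ℝ} (hv : ∀ N, 0 ≤ v N)
    (hf : ∀ᶠ N in atTop, 0 < f N ∧ ENNReal.ofReal (f N) ≤ P N)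
    (hl : Tendsto (fun N => v N * Real.log (f N)) atTop (nhds l)) :
    (l : EReal) ≤ liminf (fun N => (v N : EReal) * ENNReal.log (P N)) atTop := by
  rw [← (EReal.tendsto_coe.2 hl).liminf_eq]
  refine liminf_le_liminf ?_
  filter_upwards [hf] with N hN
  rw [EReal.coe_mul, ← ENNReal.log_ofReal_of_pos hN.1]
  exact mul_le_mul_of_nonneg_left (ENNReal.log_le_log hN.2) (EReal.coe_nonneg.2 (hv N))

lemma limsup_mul_log_le {v f : ℕ → ℝ} {P : ℕ → ENNReal} {l : ℝ} (hv : ∀ N, 0 ≤ v N)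
    (hf : ∀ᶠ N in atTop, 0 < f N ∧ P N ≤ ENNReal.ofReal (f N))
    (hl : Tendsto (fun N => v N * Real.log (f N)) atTop (nhds l)) :
    limsup (fun N => (v N : EReal) * ENNReal.log (P N)) atTop ≤ l := by
  rw [← (EReal.tendsto_coe.2 hl).limsup_eq]
  refine limsup_le_limsup ?_
  filter_upwards [hf] with N hN
  rw [EReal.coe_mul, ← ENNReal.log_ofReal_of_pos hN.1]
  exact mul_le_mul_of_nonneg_left (ENNReal.log_le_log hN.2) (EReal.coe_nonneg.2 (hv N))

/-- The logarithmic asymptotics of a product of Gaussian lower bounds. -/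
lemma tendsto_sq_mul_log_prod {ι : Type*} (T : Finset ι) (a : ι → ℝ) {s : ℕ → ℝ}
    (hs0 : ∀ᶠ N in atTop, 0 < s N) (hs : Tendsto s atTop (nhds 0)) {c : ℝ} (hc : 0 < c) :
    Tendsto (fun N => s N ^ 2 *
      Real.log ((∏ p ∈ T, c * Real.exp (-(|a p| / s N + 1) ^ 2 / 2)) * 2⁻¹)) atTop
      (nhds (-(1 / 2 * ∑ p ∈ T, a p ^ 2))) := by
  have hlim : Tendsto (fun N => s N ^ 2 * (T.card * Real.log c + Real.log 2⁻¹) +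
      ∑ p ∈ T, -(|a p| + s N) ^ 2 / 2) atTop
      (nhds ((0 : ℝ) ^ 2 * (T.card * Real.log c + Real.log 2⁻¹) + ∑ p ∈ T, -(|a p| + 0) ^ 2 / 2)) :=
    ((hs.pow 2).mul_const _).add (tendsto_finsetSum _ fun p _ =>
      (((hs.const_add _).pow 2).neg).div_const _)
  convert hlim.congr' ?_ using 2
  · rw [Finset.mul_sum, ← Finset.sum_neg_distrib]
    simp only [ne_eq, OfNat.ofNat_ne_zero, not_false_eq_true, zero_pow, zero_mul, add_zero, sq_abs,
      zero_add]
    exact Finset.sum_congr rfl fun p _ => by ring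
  · filter_upwards [hs0] with N hN
    rw [Real.log_mul (Finset.prod_ne_zero_iff.2 fun p _ => by positivity) (by norm_num),
      Real.log_prod fun p _ => by positivity]
    simp only [Real.log_mul hc.ne' (Real.exp_pos _).ne', Real.log_exp]
    rw [Finset.sum_add_distrib, Finset.sum_const, nsmul_eq_mul, add_right_comm, mul_add _ (_ + _),
      Finset.mul_sum]
    congr 1
    refine Finset.sum_congr rfl fun p _ => ?_
    field_simp

end StiefelDeviations

/-- **Moderate deviation principle for the Stiefel manifold.** Here `μ N` is the Haar
probability measure on `O(N)` (a probability measure on `N × N` matrices, concentrated on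
orthogonal matrices and invariant under left multiplication by orthogonal matrices), so
that the first `m` rows of a `μ N`-distributed matrix are Haar-distributed on the Stiefel
manifold `𝕍_{m,N}`. The sequence `β_N · V_{m,N}`, embedded into `ℝ^{m × ∞}` (product
topology), satisfies an LDP with speed `N/β_N²` and rate function `I`. -/
theorem stmt_8
    (m : ℕ)
    (μ : (N : ℕ) → Measure (Matrix (Fin N) (Fin N) ℝ))
    (hμ_prob : ∀ N, IsProbabilityMeasure (μ N))
    (hμ_supp : ∀ N, μ N {A | A * Aᵀ = 1} = 1)
    (hμ_inv : ∀ N (B : Matrix (Fin N) (Fin N) ℝ), B * Bᵀ = 1 →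
      (μ N).map (fun A => B * A) = μ N)
    (β : ℕ → ℝ) (hβ_pos : ∀ N, 0 < β N)
    (hβ_top : Tendsto β atTop atTop)
    (hβ_o : β =o[atTop] fun N => Real.sqrt N) :
    (∀ O : Set (Fin m → ℕ → ℝ), IsOpen O →
      - ⨅ A ∈ O, rateI m A ≤
        Filter.liminf (fun N => ((β N ^ 2 / N : ℝ) : EReal) *
          ENNReal.log (μ N {M | (fun i j => β N * rowsEmb m M i j) ∈ O})) atTop) ∧
    (∀ C : Set (Fin m → ℕ → ℝ), IsClosed C →
      Filter.limsup (fun N => ((β N ^ 2 / N : ℝ) : EReal) *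
          ENNReal.log (μ N {M | (fun i j => β N * rowsEmb m M i j) ∈ C})) atTop ≤
        - ⨅ A ∈ C, rateI m A) := by
  have hs : Tendsto (fun N : ℕ => β N / Real.sqrt N) atTop (nhds 0) := hβ_o.tendsto_div_nhds_zero
  have hsq : ∀ N : ℕ, (β N / Real.sqrt N) ^ 2 = β N ^ 2 / N := fun N => by
    rw [div_pow, Real.sq_sqrt (Nat.cast_nonneg N)]
  have hs0 : ∀ᶠ N : ℕ in atTop, 0 < β N / Real.sqrt N := by
    filter_upwards [eventually_ge_atTop 1] with N hN
    exact div_pos (hβ_pos N) (Real.sqrt_pos.2 (by exact_mod_cast hN))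
  have hv : ∀ N : ℕ, 0 ≤ β N ^ 2 / N := fun N => by positivity
  refine ⟨fun O hO => ?_, fun C hC => ?_⟩
  · rw [EReal.neg_le]
    refine le_iInf₂ fun A hA => ?_
    rw [EReal.neg_le]
    obtain ⟨k, ε, hε, hcyl⟩ := exists_cylinder_subset hO hA
    let T : Finset (Fin m × ℕ) := Finset.univ ×ˢ Finset.range k
    have hT := half_sum_le_rateI A T
    refine (EReal.neg_le_neg_iff.2 hT).trans ?_
    rw [← EReal.coe_neg]
    have hc : 0 < 2 * (Real.sqrt (2 * Real.pi))⁻¹ := by positivity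
    have hlim := tendsto_sq_mul_log_prod T (fun p => A p.1 p.2) hs0 hs hc
    simp only [hsq] at hlim
    refine le_liminf_mul_log hv ?_ hlim
    filter_upwards [eventually_le_measure_cylinder hβ_pos hβ_top hs k (fun p => A p.1 p.2) hε]
      with N hN
    refine ⟨by positivity, ?_⟩
    have := hN (μ N) (hμ_supp N) (hμ_inv N)
    rw [ENNReal.ofReal_mul (by positivity), ENNReal.ofReal_prod_of_nonneg fun p _ => by positivity,
      ENNReal.ofReal_inv_of_pos two_pos, ENNReal.ofReal_ofNat]
    exact this.trans (measure_mono fun M hM => hcyl _ hM)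
  · rw [EReal.le_neg]
    refine EReal.ge_of_forall_gt_iff_ge.1 fun α hα => ?_
    rw [EReal.le_neg, ← EReal.coe_neg]
    rcases le_or_gt α 0 with hα0 | hα0
    · refine (limsup_le_of_le (a := 0) (h := .of_forall fun N => ?_)).trans
        (EReal.coe_nonneg.2 (neg_nonneg.2 hα0))
      exact mul_nonpos_of_nonneg_of_nonpos (EReal.coe_nonneg.2 (hv N))
        (ENNReal.log_le_zero_iff.2 prob_le_one)
    obtain ⟨α', hαα', hα'⟩ := EReal.lt_iff_exists_real_btwn.1 hα
    rw [EReal.coe_lt_coe_iff] at hαα'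
    have hα'0 : 0 < α' := hα0.trans hαα'
    obtain ⟨k, hk⟩ := exists_forall_le_sum_of_lt_iInf_rateI hC hα'
    let δ : ℝ := (1 - α / α') / 3
    have hx : α / α' < 1 := (div_lt_one hα'0).2 hαα'
    have hx0 : 0 < α / α' := by positivity
    have hδ0 : 0 < δ := by simp only [δ]; linarith
    have hδ1 : δ < 1 := by simp only [δ]; linarith
    have hδα : α ≤ (1 - δ) ^ 3 * α' := by
      have h1 : 1 - 3 * δ ≤ (1 - δ) ^ 3 := by nlinarith [mul_pos hδ0 hδ0]
      have h2 : (1 - 3 * δ) * α' = α := by simp only [δ]; field_simp; ring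
      nlinarith
    obtain ⟨K, hK, hKN⟩ := eventually_measure_sum_sq_le (m := m) k α' hδ0 hδ1
    refine le_trans (limsup_mul_log_le
      (f := fun N => K * Real.exp (-((1 - δ) ^ 3 * α') * (N / β N ^ 2)))
      (l := -((1 - δ) ^ 3 * α')) hv ?_ ?_) (EReal.coe_le_coe_iff.2 (neg_le_neg hδα))
    · filter_upwards [hKN] with N hN
      refine ⟨by positivity, ?_⟩
      refine le_trans (measure_mono fun M hM => ?_)
        (hN (μ N) (hμ_supp N) (hμ_inv N) (β N) (hβ_pos N))
      exact hk _ hM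
    · have hlim := ((hs.pow 2).mul_const (Real.log K)).add_const (-((1 - δ) ^ 3 * α'))
      rw [zero_pow two_ne_zero, zero_mul, zero_add] at hlim
      refine hlim.congr' ?_
      filter_upwards [eventually_ge_atTop 1] with N hN
      have hN0 : (N : ℝ) ≠ 0 := by positivity
      have := (hβ_pos N).ne'
      rw [Real.log_mul hK.ne' (Real.exp_pos _).ne', Real.log_exp, hsq]
      field_simp
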